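/- For every fixed τ ∈ (0,1), the map F_τ is globally Lipschitz continuous on ℝ: for all x, y ∈ ℝ, |F_τ(x) − F_τ(y)| ≤ (exp(τ)/τ)·|x − y|. -/

import Mathlib

/-- The flow `Φ_t(x) = x / √(x² + (1 − x²)·exp(−2t))` of the ODE `x' = x − x³`. -/
noncomputable def Phi (t x : ℝ) : ℝ :=
  x / Real.sqrt (x ^ 2 + (1 - x ^ 2) * Real.exp (-2 * t))

/-- `F_τ(x) = (Φ_τ(x) − x)/τ`. -/
noncomputable def Ftau (τ x : ℝ) : ℝ := (Phi τ x - x) / τ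

lemma exp_neg_two_mul_le_radicand {t : ℝ} (ht : 0 ≤ t) (x : ℝ) :
    Real.exp (-2 * t) ≤ x ^ 2 + (1 - x ^ 2) * Real.exp (-2 * t) := by
  have h : Real.exp (-2 * t) ≤ 1 := Real.exp_le_one_iff.mpr (by linarith)
  nlinarith [sq_nonneg x]

lemma hasDerivAt_Phi {t : ℝ} (ht : 0 ≤ t) (x : ℝ) :
    HasDerivAt (Phi t)
      (Real.exp (-2 * t) / Real.sqrt (x ^ 2 + (1 - x ^ 2) * Real.exp (-2 * t)) ^ 3) x := by
  have hq : 0 < x ^ 2 + (1 - x ^ 2) * Real.exp (-2 * t) :=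
    (Real.exp_pos _).trans_le (exp_neg_two_mul_le_radicand ht x)
  have hs := Real.sqrt_pos.mpr hq
  have hsq := Real.sq_sqrt hq.le
  have hx : HasDerivAt (fun y : ℝ => y ^ 2) (2 * x) x := by
    simpa using hasDerivAt_pow 2 x
  have hg : HasDerivAt (fun y : ℝ => y ^ 2 + (1 - y ^ 2) * Real.exp (-2 * t))
      (2 * x + -(2 * x) * Real.exp (-2 * t)) x :=
    hx.add ((hx.const_sub 1).mul_const _)
  refine ((hasDerivAt_id x).div (hg.sqrt hq.ne') hs.ne').congr_deriv ?_
  simp only [id]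
  generalize Real.sqrt (x ^ 2 + (1 - x ^ 2) * Real.exp (-2 * t)) = s at hs hsq ⊢
  generalize Real.exp (-2 * t) = E at hsq ⊢
  field_simp
  linear_combination hsq

lemma deriv_Phi_le_exp {t : ℝ} (ht : 0 ≤ t) (x : ℝ) :
    Real.exp (-2 * t) / Real.sqrt (x ^ 2 + (1 - x ^ 2) * Real.exp (-2 * t)) ^ 3
      ≤ Real.exp t := by
  have hs : Real.exp (-t) ≤ Real.sqrt (x ^ 2 + (1 - x ^ 2) * Real.exp (-2 * t)) := by
    refine Real.le_sqrt_of_sq_le (le_of_eq_of_le ?_ (exp_neg_two_mul_le_radicand ht x))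
    rw [← Real.exp_nat_mul]
    congr 1
    push_cast
    ring
  have h : Real.exp (-2 * t) = Real.exp t * Real.exp (-t) ^ 3 := by
    rw [← Real.exp_nat_mul, ← Real.exp_add]
    congr 1
    push_cast
    ring
  rw [div_le_iff₀ (pow_pos ((Real.exp_pos _).trans_le hs) 3)]
  refine h.trans_le ?_
  gcongr

/-- For fixed `τ ∈ (0,1)`, `F_τ` is globally Lipschitz with constant `exp(τ)/τ`. -/
theorem Ftau_lipschitz (τ : ℝ) (hτ : τ ∈ Set.Ioo (0 : ℝ) 1) :
    ∀ x y : ℝ, |Ftau τ x - Ftau τ y| ≤ (Real.exp τ / τ) * |x - y| := by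
  intro x y
  have hτ0 : 0 < τ := hτ.1
  have hderiv (z : ℝ) : HasDerivAt (Ftau τ) _ z :=
    ((hasDerivAt_Phi hτ0.le z).sub (hasDerivAt_id z)).div_const τ
  refine convex_univ.norm_image_sub_le_of_norm_hasDerivWithin_le
    (fun z _ => (hderiv z).hasDerivWithinAt) (fun z _ => ?_) (Set.mem_univ y) (Set.mem_univ x)
  have hnonneg : 0 ≤ Real.exp (-2 * τ) /
      Real.sqrt (z ^ 2 + (1 - z ^ 2) * Real.exp (-2 * τ)) ^ 3 := by positivity
  have hone : 1 ≤ Real.exp τ := Real.one_le_exp hτ0.le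
  rw [Real.norm_eq_abs, abs_div, abs_of_pos hτ0]
  gcongr
  rw [abs_le]
  constructor <;> linarith [deriv_Phi_le_exp hτ0.le z]
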